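/- Let k ≥ 2 be an integer, let Σ ∈ ℝ^{k×k} be symmetric positive definite, and let j ∈ {1,…,k}. Then the matrix R(Σ, j) = Θ(Σ, j) − (1/Σ(j,j)) r_j r_jᵀ is symmetric positive definite, the function μ ↦ P(μ, Σ) has a partial derivative with respect to its j-th coordinate at μ = 0, and this partial derivative equals (2π Σ(j,j))^{−1/2} · P(0_{k−1}, R(Σ, j)). -/

import Mathlib

open MeasureTheory Real Matrix

/-- Multivariate Gaussian density `φ(x; μ, S)` on `ι → ℝ`. -/
noncomputable def gaussDensity {ι : Type*} [Fintype ι] [DecidableEq ι] (μ : ι → ℝ) (S : Matrix ι ι ℝ)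
    (x : ι → ℝ) : ℝ :=
  (2 * π) ^ (-(Fintype.card ι : ℝ) / 2) * S.det ^ (-(1 : ℝ) / 2) *
    Real.exp (-(1 / 2) * ((x - μ) ⬝ᵥ (S⁻¹ *ᵥ (x - μ))))

/-- Orthant probability `P(μ, S) = ∫_{(0,∞)^k} φ(x; μ, S) dx`. -/
noncomputable def orthantProb {ι : Type*} [Fintype ι] [DecidableEq ι] (μ : ι → ℝ) (S : Matrix ι ι ℝ) : ℝ :=
  ∫ x in {x : ι → ℝ | ∀ i, 0 < x i}, gaussDensity μ S x

/-- Schur complement `R(S, l) = Θ(S, l) − (1/S l l) r_l r_lᵀ`, indexed by `{i // i ≠ l}`. -/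
noncomputable def schurR {ι : Type*} (S : Matrix ι ι ℝ) (l : ι) :
    Matrix {i : ι // i ≠ l} {i : ι // i ≠ l} ℝ :=
  fun i j => S i.1 j.1 - S i.1 l * S j.1 l / S l l

/-- The vector `d(τ)` with `d(τ)(l) = τ(l) (2π S l l)^{-1/2} P(0, R(Γ_τ S Γ_τ, l))`. -/
noncomputable def dvec {ι : Type*} [Fintype ι] [DecidableEq ι] (S : Matrix ι ι ℝ)
    (τ : ι → ℝ) : ι → ℝ :=
  fun l => τ l * (2 * π * S l l) ^ (-(1 : ℝ) / 2) *
    orthantProb (0 : {i : ι // i ≠ l} → ℝ)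
      (schurR (Matrix.diagonal τ * S * Matrix.diagonal τ) l)

/-- The block matrix `T1 = [[0, I_m], [−I_m, 0]]` on `Fin m ⊕ Fin m`. -/
noncomputable def T1 (m : ℕ) : Matrix (Fin m ⊕ Fin m) (Fin m ⊕ Fin m) ℝ :=
  Matrix.fromBlocks 0 1 (-1) 0

section SchurComplement

variable {ι : Type*} [Fintype ι] [DecidableEq ι]

/-- The principal minor of `S⁻¹` avoiding `j` is a left inverse of the Schur complement. -/
lemma inv_submatrix_mul_schurR {S : Matrix ι ι ℝ} (hS : S.PosDef) (j : ι) :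
    (S⁻¹.submatrix Subtype.val Subtype.val : Matrix {i // i ≠ j} {i // i ≠ j} ℝ) * schurR S j
      = 1 := by
  have hj : S j j ≠ 0 := hS.diag_pos.ne'
  have hmul : S⁻¹ * S = 1 := nonsing_inv_mul _ ((isUnit_iff_isUnit_det _).1 hS.isUnit)
  have hsymm : ∀ a b, S a b = S b a := fun a b => by
    simpa using (hS.isHermitian.apply a b).symm
  ext a b
  have hentry : ∀ c, ∑ m : {i // i ≠ j}, S⁻¹ a m * S m c
      = (1 : Matrix ι ι ℝ) a c - S⁻¹ a j * S j c := fun c => by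
    rw [← hmul, mul_apply, Fintype.sum_eq_add_sum_subtype_ne _ j]
    ring
  have hsplit : ∀ m : {i // i ≠ j}, S⁻¹ a m * (S m b - S m j * S b j / S j j)
      = S⁻¹ a m * S m b - S⁻¹ a m * S m j * (S b j / S j j) := fun m => by ring
  simp only [mul_apply, submatrix_apply, schurR, hsplit, Finset.sum_sub_distrib,
    ← Finset.sum_mul, hentry, one_apply, a.2, hsymm j b, Subtype.ext_iff, if_false]
  field_simp
  ring

lemma schurR_inv {S : Matrix ι ι ℝ} (hS : S.PosDef) (j : ι) :
    (schurR S j)⁻¹ = S⁻¹.submatrix Subtype.val Subtype.val :=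
  inv_eq_left_inv (inv_submatrix_mul_schurR hS j)

lemma schurR_posDef {S : Matrix ι ι ℝ} (hS : S.PosDef) (j : ι) : (schurR S j).PosDef := by
  have h : (S⁻¹.submatrix Subtype.val Subtype.val :
      Matrix {i // i ≠ j} {i // i ≠ j} ℝ).PosDef := hS.inv.submatrix Subtype.val_injective
  rw [← inv_eq_right_inv (inv_submatrix_mul_schurR hS j)]
  exact h.inv

lemma det_eq_mul_det_schurR {S : Matrix ι ι ℝ} (hS : S.PosDef) (j : ι) :
    S.det = S j j * (schurR S j).det := by
  have hj : S j j ≠ 0 := hS.diag_pos.ne'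
  have hsymm : ∀ a b, S a b = S b a := fun a b => by
    simpa using (hS.isHermitian.apply a b).symm
  let e : {i // i ≠ j} ⊕ Unit ≃ ι :=
    (Equiv.optionEquivSumPUnit {i // i ≠ j}).symm.trans (Equiv.optionSubtypeNe j)
  let D : Matrix Unit Unit ℝ := of fun _ _ => S j j
  have hD : IsUnit D.det := by simpa [D] using hj
  let := invertibleOfIsUnitDet D hD
  have hinv : ⅟D = of fun _ _ => (S j j)⁻¹ := by
    apply invOf_eq_right_inv
    ext
    simp [mul_apply, D, hj]
  have hblock : S.submatrix e e = fromBlocks (S.submatrix Subtype.val Subtype.val)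
      (of fun (a : {i // i ≠ j}) (_ : Unit) => S a j)
      (of fun (_ : Unit) (a : {i // i ≠ j}) => S j a) D := by
    ext a b
    rcases a with a | a <;> rcases b with b | b <;> simp [e, D]
  rw [← det_submatrix_equiv_self e, hblock, det_fromBlocks₂₂, hinv]
  congr 1
  · simp [D]
  · congr 1
    ext a b
    simp [schurR, mul_apply, hsymm j b]
    ring

end SchurComplement

section QuadraticForm

variable {ι : Type*} [Fintype ι]

lemma continuous_dotProduct_mulVec_self (M : Matrix ι ι ℝ) :
    Continuous fun x : ι → ℝ => x ⬝ᵥ (M *ᵥ x) := by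
  simp only [dotProduct, mulVec]
  fun_prop

lemma Matrix.PosDef.exists_mul_sum_sq_le {M : Matrix ι ι ℝ} (hM : M.PosDef) :
    ∃ c > 0, ∀ x : ι → ℝ, c * ∑ i, x i ^ 2 ≤ x ⬝ᵥ (M *ᵥ x) := by
  have hpos : ∀ x : ι → ℝ, x ≠ 0 → 0 < x ⬝ᵥ (M *ᵥ x) := fun x hx => by
    simpa using hM.dotProduct_mulVec_pos hx
  obtain hι | hι := isEmpty_or_nonempty ι
  · exact ⟨1, one_pos, fun x => by simp⟩
  obtain ⟨x₀, hx₀, hmin⟩ := (isCompact_sphere (0 : ι → ℝ) 1).exists_isMinOn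
    (NormedSpace.sphere_nonempty.2 zero_le_one) (continuous_dotProduct_mulVec_self M).continuousOn
  have hx₀' : x₀ ≠ 0 := by
    rintro rfl
    simp at hx₀
  have hcard : (0 : ℝ) < Fintype.card ι := by exact_mod_cast Fintype.card_pos
  refine ⟨(x₀ ⬝ᵥ (M *ᵥ x₀)) / Fintype.card ι, div_pos (hpos _ hx₀') hcard, fun x => ?_⟩
  obtain rfl | hx := eq_or_ne x 0
  · simp
  have hn : 0 < ‖x‖ := norm_pos_iff.2 hx
  have h1 : x₀ ⬝ᵥ (M *ᵥ x₀) ≤ (‖x‖⁻¹ • x) ⬝ᵥ (M *ᵥ (‖x‖⁻¹ • x)) :=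
    hmin (by simp [norm_smul, hn.ne'])
  have h2 : (‖x‖⁻¹ • x) ⬝ᵥ (M *ᵥ (‖x‖⁻¹ • x)) * ‖x‖ ^ 2 = x ⬝ᵥ (M *ᵥ x) := by
    simp only [mulVec_smul, smul_dotProduct, dotProduct_smul, smul_eq_mul]
    field_simp
  have h3 : ∑ i, x i ^ 2 ≤ Fintype.card ι * ‖x‖ ^ 2 := by
    calc ∑ i, x i ^ 2 ≤ ∑ _i : ι, ‖x‖ ^ 2 := Finset.sum_le_sum fun i _ => by
          rw [← sq_abs]
          exact pow_le_pow_left₀ (abs_nonneg _) (norm_le_pi_norm x i) 2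
      _ = _ := by simp
  calc (x₀ ⬝ᵥ (M *ᵥ x₀)) / Fintype.card ι * ∑ i, x i ^ 2
      ≤ (x₀ ⬝ᵥ (M *ᵥ x₀)) / Fintype.card ι * (Fintype.card ι * ‖x‖ ^ 2) :=
        mul_le_mul_of_nonneg_left h3 (div_pos (hpos _ hx₀') hcard).le
    _ = (x₀ ⬝ᵥ (M *ᵥ x₀)) * ‖x‖ ^ 2 := by field_simp
    _ ≤ _ := by
        rw [← h2]
        exact mul_le_mul_of_nonneg_right h1 (sq_nonneg _)

lemma integrable_exp_neg_mul_sum_sq {c : ℝ} (hc : 0 < c) :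
    Integrable fun x : ι → ℝ => Real.exp (-c * ∑ i, x i ^ 2) := by
  simp only [Finset.mul_sum, Real.exp_sum]
  exact Integrable.fintype_prod (f := fun (_ : ι) (v : ℝ) => Real.exp (-c * v ^ 2))
    fun _ => integrable_exp_neg_mul_sq hc

lemma Matrix.PosDef.integrable_exp_neg_half {M : Matrix ι ι ℝ} (hM : M.PosDef) :
    Integrable fun x : ι → ℝ => Real.exp (-(1 / 2) * (x ⬝ᵥ (M *ᵥ x))) := by
  obtain ⟨c, hc, h⟩ := hM.exists_mul_sum_sq_le
  refine (integrable_exp_neg_mul_sum_sq (half_pos hc)).mono' ?_ (.of_forall fun x => ?_)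
  · exact (Real.continuous_exp.comp
      ((continuous_dotProduct_mulVec_self M).const_mul _)).aestronglyMeasurable
  · rw [Real.norm_of_nonneg (Real.exp_pos _).le, Real.exp_le_exp]
    linarith [h x]

end QuadraticForm

section InsertCoordinate

variable {ι : Type*} [DecidableEq ι]

/-- The vector with `j`-th coordinate `p.1` and remaining coordinates `p.2`. -/
def insertCoord (j : ι) (p : ℝ × ({i // i ≠ j} → ℝ)) : ι → ℝ :=
  fun i => if h : i = j then p.1 else p.2 ⟨i, h⟩

@[simp]
lemma insertCoord_self (j : ι) (p : ℝ × ({i // i ≠ j} → ℝ)) : insertCoord j p j = p.1 := by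
  simp [insertCoord]

@[simp]
lemma insertCoord_coe (j : ι) (p : ℝ × ({i // i ≠ j} → ℝ)) (i : {i // i ≠ j}) :
    insertCoord j p i = p.2 i := by
  simp [insertCoord, i.2]

lemma continuous_insertCoord (j : ι) : Continuous (insertCoord j) := by
  refine continuous_pi fun i => ?_
  by_cases h : i = j
  · simpa [insertCoord, h] using continuous_fst
  · simp only [insertCoord, h, dite_false]
    fun_prop

variable [Fintype ι]

lemma exists_measurableEquiv_eq_insertCoord (j : ι) :
    ∃ e : ℝ × ({i // i ≠ j} → ℝ) ≃ᵐ (ι → ℝ), MeasurePreserving e ∧ ⇑e = insertCoord j := by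
  let e₁ := MeasurableEquiv.piEquivPiSubtypeProd (fun _ : ι => ℝ) (· = j)
  have h₁ : MeasurePreserving e₁ := by
    convert volume_preserving_piEquivPiSubtypeProd (fun _ : ι => ℝ) (· = j)
  let e₂ := (MeasurableEquiv.funUnique {i // i = j} ℝ).prodCongr
    (MeasurableEquiv.refl ({i // i ≠ j} → ℝ))
  have h₂ : MeasurePreserving e₂ :=
    (volume_preserving_funUnique {i // i = j} ℝ).prod (MeasurePreserving.id volume)
  refine ⟨(e₁.trans e₂).symm, MeasurePreserving.symm _ (h₂.comp h₁), ?_⟩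
  ext1 p
  refine (MeasurableEquiv.symm_apply_eq _).2 (Prod.ext ?_ ?_)
  · exact (insertCoord_self j p).symm
  · ext i
    exact (insertCoord_coe j p i).symm

lemma sum_sq_insertCoord (j : ι) (p : ℝ × ({i // i ≠ j} → ℝ)) :
    ∑ i, insertCoord j p i ^ 2 = p.1 ^ 2 + ∑ i, p.2 i ^ 2 := by
  rw [Fintype.sum_eq_add_sum_subtype_ne _ j]
  simp

lemma insertCoord_zero_dotProduct_mulVec (M : Matrix ι ι ℝ) (j : ι) (y : {i // i ≠ j} → ℝ) :
    insertCoord j (0, y) ⬝ᵥ (M *ᵥ insertCoord j (0, y))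
      = y ⬝ᵥ (M.submatrix Subtype.val Subtype.val *ᵥ y) := by
  simp [dotProduct, mulVec, Fintype.sum_eq_add_sum_subtype_ne _ j]

end InsertCoordinate

lemma measurableSet_orthant (ι : Type*) [Fintype ι] : MeasurableSet {x : ι → ℝ | ∀ i, 0 < x i} := by
  simp only [Set.ofPred_forall]
  exact MeasurableSet.iInter fun i => measurableSet_lt measurable_const (measurable_pi_apply i)

lemma hasDerivAt_integral_Ioi_neg {G : ℝ → ℝ} (hG : Continuous G) (hi : Integrable G) :
    HasDerivAt (fun t => ∫ s in Set.Ioi (-t), G s) (G 0) 0 := by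
  have h : (fun t => ∫ s in Set.Ioi (-t), G s)
      = fun t => (∫ s in (-t)..0, G s) + ∫ s in Set.Ioi 0, G s := by
    ext t
    rw [intervalIntegral.integral_interval_add_Ioi hi.integrableOn hi.integrableOn]
  rw [h]
  have h0 : HasDerivAt (fun u => ∫ s in u..0, G s) (-G 0) (-0) := by
    simpa using intervalIntegral.integral_hasDerivAt_left (hG.intervalIntegrable (-0) 0)
      hG.stronglyMeasurable.stronglyMeasurableAtFilter hG.continuousAt
  simpa using (h0.comp (0 : ℝ) (hasDerivAt_neg 0)).add_const (∫ s in Set.Ioi 0, G s)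

section Orthant

variable {ι : Type*} [Fintype ι] [DecidableEq ι]

/-- The unnormalised Gaussian density with precision matrix `M`, with the `j`-th coordinate fixed
to `s` and the other coordinates integrated over the positive orthant. -/
noncomputable def orthantMarginal (M : Matrix ι ι ℝ) (j : ι) (s : ℝ) : ℝ :=
  ∫ y in {y : {i // i ≠ j} → ℝ | ∀ i, 0 < y i},
    Real.exp (-(1 / 2) * (insertCoord j (s, y) ⬝ᵥ (M *ᵥ insertCoord j (s, y))))

lemma continuous_orthantMarginal {M : Matrix ι ι ℝ} (hM : M.PosDef) (j : ι) :
    Continuous (orthantMarginal M j) := by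
  obtain ⟨c, hc, h⟩ := hM.exists_mul_sum_sq_le
  have hF : Continuous fun p : ℝ × ({i // i ≠ j} → ℝ) =>
      Real.exp (-(1 / 2) * (insertCoord j p ⬝ᵥ (M *ᵥ insertCoord j p))) :=
    Real.continuous_exp.comp
      (((continuous_dotProduct_mulVec_self M).comp (continuous_insertCoord j)).const_mul _)
  refine continuous_of_dominated (bound := fun y => Real.exp (-(c / 2) * ∑ i, y i ^ 2))
    (fun s => (hF.comp (Continuous.prodMk_right s)).aestronglyMeasurable)
    (fun s => .of_forall fun y => ?_)
    (integrable_exp_neg_mul_sum_sq (half_pos hc)).integrableOn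
    (.of_forall fun y => hF.comp (Continuous.prodMk_left y))
  rw [Real.norm_of_nonneg (Real.exp_pos _).le, Real.exp_le_exp]
  have h1 := h (insertCoord j (s, y))
  rw [sum_sq_insertCoord] at h1
  nlinarith [mul_nonneg hc.le (sq_nonneg s)]

lemma integrable_insertCoord {M : Matrix ι ι ℝ} (hM : M.PosDef) (j : ι) :
    Integrable fun p : ℝ × ({i // i ≠ j} → ℝ) =>
      Real.exp (-(1 / 2) * (insertCoord j p ⬝ᵥ (M *ᵥ insertCoord j p))) := by
  obtain ⟨e, he, hej⟩ := exists_measurableEquiv_eq_insertCoord j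
  rw [← hej]
  exact (he.integrable_comp_emb e.measurableEmbedding).2 hM.integrable_exp_neg_half

lemma integrable_orthantMarginal {M : Matrix ι ι ℝ} (hM : M.PosDef) (j : ι) :
    Integrable (orthantMarginal M j) := by
  have h := (integrable_insertCoord hM j).integrableOn
    (s := Set.univ ×ˢ {y : {i // i ≠ j} → ℝ | ∀ i, 0 < y i})
  rw [IntegrableOn, Measure.volume_eq_prod, ← Measure.prod_restrict, Measure.restrict_univ] at h
  exact h.integral_prod_left

lemma setIntegral_orthant_sub_single {M : Matrix ι ι ℝ} (hM : M.PosDef) (j : ι) (t : ℝ) :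
    ∫ x in {x : ι → ℝ | ∀ i, 0 < x i},
      Real.exp (-(1 / 2) * ((x - Pi.single j t) ⬝ᵥ (M *ᵥ (x - Pi.single j t))))
      = ∫ s in Set.Ioi (-t), orthantMarginal M j s := by
  let F : (ι → ℝ) → ℝ := fun x => Real.exp (-(1 / 2) * (x ⬝ᵥ (M *ᵥ x)))
  obtain ⟨e, he, hej⟩ := exists_measurableEquiv_eq_insertCoord j
  have hadd : MeasurePreserving (· + (Pi.single j t : ι → ℝ)) :=
    measurePreserving_add_right volume _
  have hpre : e ⁻¹' ((· + (Pi.single j t : ι → ℝ)) ⁻¹' {x | ∀ i, 0 < x i})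
      = Set.Ioi (-t) ×ˢ {y : {i // i ≠ j} → ℝ | ∀ i, 0 < y i} := by
    ext p
    simp only [hej, Set.mem_preimage, Set.mem_ofPred_eq, Set.mem_prod, Set.mem_Ioi]
    constructor
    · intro h
      refine ⟨?_, fun i => ?_⟩
      · have := h j
        simp at this
        linarith
      · simpa [i.2] using h i
    · rintro ⟨h1, h2⟩ i
      by_cases hi : i = j
      · subst hi
        simp
        linarith
      · simpa [hi, insertCoord] using h2 ⟨i, hi⟩
  calc _ = ∫ x in (· + (Pi.single j t : ι → ℝ)) ⁻¹' {x | ∀ i, 0 < x i}, F x := by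
        rw [← hadd.setIntegral_preimage_emb (measurableEmbedding_addRight _)]
        simp [F]
    _ = ∫ p in Set.Ioi (-t) ×ˢ {y : {i // i ≠ j} → ℝ | ∀ i, 0 < y i}, F (insertCoord j p) := by
        rw [← he.setIntegral_preimage_emb e.measurableEmbedding, hpre, hej]
    _ = _ := setIntegral_prod _ (integrable_insertCoord hM j).integrableOn

lemma orthantMarginal_zero {S : Matrix ι ι ℝ} (hS : S.PosDef) (j : ι) :
    (2 * π) ^ (-(Fintype.card ι : ℝ) / 2) * S.det ^ (-(1 : ℝ) / 2) * orthantMarginal S⁻¹ j 0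
      = (2 * π * S j j) ^ (-(1 : ℝ) / 2) *
        orthantProb (0 : {i : ι // i ≠ j} → ℝ) (schurR S j) := by
  have hcard : (Fintype.card ι : ℝ) = Fintype.card {i // i ≠ j} + 1 := by
    have : 0 < Fintype.card ι := Fintype.card_pos_iff.2 ⟨j⟩
    rw [Fintype.card_subtype_compl, Fintype.card_subtype_eq, Nat.cast_sub this]
    simp
  have hpi : (0 : ℝ) < 2 * π := by positivity
  have hj : 0 < S j j := hS.diag_pos
  simp only [orthantProb, gaussDensity, orthantMarginal, insertCoord_zero_dotProduct_mulVec,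
    sub_zero, integral_const_mul, schurR_inv hS]
  rw [det_eq_mul_det_schurR hS j, Real.mul_rpow hj.le (schurR_posDef hS j).det_pos.le,
    Real.mul_rpow hpi.le hj.le, hcard, neg_add, add_div, Real.rpow_add hpi]
  ring

lemma hasDerivAt_orthantProb {S : Matrix ι ι ℝ} (hS : S.PosDef) (j : ι) :
    HasDerivAt (fun t : ℝ => orthantProb (Pi.single j t) S)
      ((2 * π * S j j) ^ (-(1 : ℝ) / 2) *
        orthantProb (0 : {i : ι // i ≠ j} → ℝ) (schurR S j)) 0 := by
  rw [← orthantMarginal_zero hS j]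
  simp only [orthantProb, gaussDensity, integral_const_mul,
    setIntegral_orthant_sub_single hS.inv j]
  exact (hasDerivAt_integral_Ioi_neg (continuous_orthantMarginal hS.inv j)
    (integrable_orthantMarginal hS.inv j)).const_mul _

end Orthant


/-- For `k ≥ 2`, `Σ` symmetric positive definite and `j ∈ {1,…,k}`, the Schur
complement `R(Σ, j)` is symmetric positive definite, and the partial derivative of
`μ ↦ P(μ, Σ)` in the `j`-th coordinate at `μ = 0` exists and equals
`(2π Σ j j)^{-1/2} · P(0_{k-1}, R(Σ, j))`. -/
theorem stmt0 {k : ℕ} (hk : 2 ≤ k) (S : Matrix (Fin k) (Fin k) ℝ) (hS : S.PosDef)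
    (j : Fin k) :
    (schurR S j).PosDef ∧
    HasDerivAt (fun t : ℝ => orthantProb (Pi.single j t) S)
      ((2 * π * S j j) ^ (-(1 : ℝ) / 2) *
        orthantProb (0 : {i : Fin k // i ≠ j} → ℝ) (schurR S j)) 0 := by
  exact ⟨schurR_posDef hS j, hasDerivAt_orthantProb hS j⟩
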